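/- arXiv:2306.13560 — 2 statements merged into one kernel-verified Lean document; each statement's English description precedes it below -/
import Mathlib

section
/- Let d ≥ 1 and n ≥ d+1, and let F be a family of (d+1)-element subsets of {1,…,n} that is a basis of the d-volume rigidity matroid R_n^d (i.e. |F| = d·n − (d²+d−1) and there exists a configuration p such that the gradients ∇vol_σ(p) for σ ∈ F are linearly independent). Then for every k with 0 ≤ k ≤ d, the number of (k+1)-element subsets of {1,…,n} that are contained in some member of F is at least C(d+1, k+1) + Σ_{l=0}^{d−1} (n−d−1)·C(d−l, k−l), where C(a,b) denotes the binomial coefficient with the convention C(a,b) = 0 whenever b < 0. -/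
/-- The signed `d`-volume of the `(d+1)`-element simplex `σ ⊆ Fin n` at the
configuration `p : Fin n → Fin d → ℝ`: the determinant of the `(d+1) × (d+1)` matrix whose
`j`-th column has first entry `1` followed by the `d` coordinates of the `j`-th point of `σ`
(in increasing order).  Junk value `0` if `σ` does not have `d+1` elements. -/
noncomputable def vol {n : ℕ} (d : ℕ) (σ : Finset (Fin n)) (p : Fin n → Fin d → ℝ) : ℝ :=
  if h : σ.card = d + 1 then
    Matrix.det
      ((Matrix.of (Fin.cons (fun _ => (1 : ℝ)) fun i j => p (σ.orderEmbOfFin h j) i) :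
        Matrix (Fin (d + 1)) (Fin (d + 1)) ℝ))
  else 0

section WedgeAlgebra

variable {V A : Type*} [AddCommGroup V] [Module ℝ V] [Ring A] [Algebra ℝ A]

/-- Product of the images of a list of vectors. -/
def wp (G : V →ₗ[ℝ] A) (l : List V) : A := (l.map G).prod

lemma wp_append (G : V →ₗ[ℝ] A) (l l' : List V) : wp G (l ++ l') = wp G l * wp G l' := by
  simp [wp]

lemma wp_cons (G : V →ₗ[ℝ] A) (x : V) (l : List V) : wp G (x :: l) = G x * wp G l := by
  simp [wp]

lemma wp_anti (G : V →ₗ[ℝ] A) (hG : ∀ x, G x * G x = 0) (x y : V) :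
    G x * G y = - (G y * G x) := by
  have h := hG (x + y)
  rw [map_add, mul_add, add_mul, add_mul, hG, hG, zero_add, add_zero] at h
  exact eq_neg_of_add_eq_zero_right h

lemma wp_perm (G : V →ₗ[ℝ] A) (hG : ∀ x, G x * G x = 0) {l l' : List V} (h : l.Perm l') :
    ∃ ε : ℝ, ε ≠ 0 ∧ wp G l = ε • wp G l' := by
  induction h with
  | nil => exact ⟨1, one_ne_zero, by simp⟩
  | cons x _ ih =>
    obtain ⟨ε, h0, h⟩ := ih
    exact ⟨ε, h0, by rw [wp_cons, wp_cons, h, mul_smul_comm]⟩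
  | swap x y l =>
    refine ⟨-1, by norm_num, ?_⟩
    rw [wp_cons, wp_cons, wp_cons, wp_cons, ← mul_assoc, ← mul_assoc, wp_anti G hG y x]
    simp
  | trans _ _ ih1 ih2 =>
    obtain ⟨ε, h0, h⟩ := ih1
    obtain ⟨ε', h0', h'⟩ := ih2
    exact ⟨ε * ε', mul_ne_zero h0 h0', by rw [h, h', mul_smul]⟩

lemma wp_dup (G : V →ₗ[ℝ] A) (hG : ∀ x, G x * G x = 0) {l : List V} (h : ¬ l.Nodup) :
    wp G l = 0 := by
  classical
  induction l with
  | nil => simp at h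
  | cons x l ih =>
    rw [List.nodup_cons] at h
    by_cases hx : x ∈ l
    · obtain ⟨ε, -, he⟩ := wp_perm G hG (List.perm_cons_erase hx)
      rw [wp_cons, he, wp_cons, mul_smul_comm, ← mul_assoc, hG, zero_mul, smul_zero]
    · rw [wp_cons, ih (by tauto), mul_zero]

lemma wp_mem_span (G : V →ₗ[ℝ] A) {κ : Type*} (e : κ → V)
    (he : ⊤ ≤ Submodule.span ℝ (Set.range e)) (l : List V) :
    wp G l ∈ Submodule.span ℝ {a | ∃ t : List κ, t.length = l.length ∧ a = wp G (t.map e)} := by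
  induction l with
  | nil => exact Submodule.subset_span ⟨[], rfl, rfl⟩
  | cons x l ih =>
    rw [wp_cons]
    have hx : G x ∈ Submodule.span ℝ (G '' Set.range e) := by
      rw [Submodule.span_image]
      exact Submodule.mem_map_of_mem (he trivial)
    have := Submodule.mul_mem_mul hx ih
    rw [Submodule.span_mul_span] at this
    refine Submodule.span_mono ?_ this
    rintro _ ⟨_, ⟨_, ⟨v, rfl⟩, rfl⟩, _, ⟨t, ht, rfl⟩, rfl⟩
    exact ⟨v :: t, by simp [ht], by simp [wp_cons]⟩

/-- Product over a finite set of indices (in some order). -/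
noncomputable def wf (G : V →ₗ[ℝ] A) {I : Type*} (f : I → V) (S : Finset I) : A :=
  wp G (S.toList.map f)

lemma wf_mul_disj (G : V →ₗ[ℝ] A) (hG : ∀ x, G x * G x = 0) {I : Type*} [DecidableEq I]
    (f : I → V) {S T : Finset I} (h : Disjoint T S) :
    ∃ ε : ℝ, ε ≠ 0 ∧ wf G f T * wf G f S = ε • wf G f (T ∪ S) := by
  unfold wf
  rw [← wp_append, ← List.map_append]
  apply wp_perm G hG
  apply List.Perm.map
  rw [List.perm_ext_iff_of_nodup]
  · simp
  · rw [List.nodup_append']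
    refine ⟨T.nodup_toList, S.nodup_toList, ?_⟩
    intro a ha hb
    exact (Finset.disjoint_left.1 h) (by simpa using ha) (by simpa using hb)
  · exact Finset.nodup_toList _

lemma wf_mul_not_disj (G : V →ₗ[ℝ] A) (hG : ∀ x, G x * G x = 0) {I : Type*} [DecidableEq I]
    (f : I → V) {S T : Finset I} (h : ¬ Disjoint T S) :
    wf G f T * wf G f S = 0 := by
  unfold wf
  rw [← wp_append]
  apply wp_dup G hG
  rw [Finset.not_disjoint_iff] at h
  obtain ⟨a, ha, hb⟩ := h
  rw [List.nodup_append']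
  rintro ⟨-, -, h3⟩
  exact h3 (List.mem_map_of_mem (f := f) (Finset.mem_toList.2 ha))
    (List.mem_map_of_mem (f := f) (Finset.mem_toList.2 hb))

/-- Multiplying a relation in degree `k+1` to the top degree. -/
lemma key_step {d k : ℕ} {M : Type*} [Fintype M]
    (G : V →ₗ[ℝ] A) (hG : ∀ x, G x * G x = 0) (f : Fin (d + 1) → V) (h : M → V)
    (H : LinearIndependent ℝ (fun x : Option (Fin d × M) => x.elim (wf G f Finset.univ)
      (fun q => wf G f (Finset.univ.erase q.1.succ) * G (h q.2))))
    (a : Finset (Fin (d + 1)) → ℝ) (c : Finset (Fin (d + 1)) → M → ℝ)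
    (hrel : ∑ S ∈ Finset.univ.powersetCard (k + 1), a S • wf G f S
      + ∑ S ∈ Finset.univ.powersetCard k, ∑ m, c S m • (wf G f S * G (h m)) = 0)
    (U : Finset (Fin (d + 1))) (hU : U.card = k + 1)
    (h0 : 0 ∈ U → ∀ m, c (U.erase 0) m = 0) :
    a U = 0 ∧ ∀ i ∈ U, ∀ m, c (U.erase i) m = 0 := by
  classical
  obtain ⟨ε, hε, he⟩ := wf_mul_disj G hG f (disjoint_compl_left (a := U))
  have hi : ∀ i, ∃ ε : ℝ, ε ≠ 0 ∧ (i ∈ U → wf G f Uᶜ * wf G f (U.erase i) =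
      ε • wf G f (Finset.univ.erase i)) := by
    intro i
    have hdis : Disjoint Uᶜ (U.erase i) :=
      (disjoint_compl_left (a := U)).mono_right (Finset.erase_subset _ _)
    obtain ⟨ε, hε, he⟩ := wf_mul_disj G hG f hdis
    refine ⟨ε, hε, fun hi => ?_⟩
    rw [he]
    congr 2
    ext x
    simp only [Finset.mem_union, Finset.mem_compl, Finset.mem_erase, Finset.mem_univ, and_true]
    by_cases hx : x = i
    · subst hx; simp [hi]
    · simp [hx]; tauto
  choose η hη hηe using hi
  have h1 : wf G f Uᶜ * ∑ S ∈ Finset.univ.powersetCard (k + 1), a S • wf G f S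
      = (ε * a U) • wf G f Finset.univ := by
    rw [Finset.mul_sum, Finset.sum_eq_single U]
    · rw [mul_smul_comm, he, smul_smul, mul_comm, Finset.union_comm, Finset.union_compl]
    · intro S hS hne
      rw [Finset.mem_powersetCard] at hS
      rw [mul_smul_comm, wf_mul_not_disj G hG, smul_zero]
      intro hd
      apply hne
      apply Finset.eq_of_subset_of_card_le
      · intro x hx
        by_contra hxU
        exact Finset.disjoint_left.1 hd (Finset.mem_compl.2 hxU) hx
      · omega
    · intro hn
      exact absurd (Finset.mem_powersetCard.2 ⟨Finset.subset_univ _, hU⟩) hn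
  have h2 : wf G f Uᶜ * ∑ S ∈ Finset.univ.powersetCard k, ∑ m, c S m • (wf G f S * G (h m))
      = ∑ i ∈ U, ∑ m, (η i * c (U.erase i) m) • (wf G f (Finset.univ.erase i) * G (h m)) := by
    rw [Finset.mul_sum]
    rw [← Finset.sum_subset (Finset.powersetCard_mono (Finset.subset_univ U))]
    · symm
      refine Finset.sum_bij (fun i _ => U.erase i) ?_ ?_ ?_ ?_
      · intro i hi
        rw [Finset.mem_powersetCard]
        exact ⟨Finset.erase_subset _ _, by rw [Finset.card_erase_of_mem hi]; omega⟩
      · intro i hi j hj hij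
        by_contra hne
        have : i ∈ U.erase j := Finset.mem_erase.2 ⟨hne, hi⟩
        rw [← hij] at this
        simp at this
      · intro S hS
        rw [Finset.mem_powersetCard] at hS
        obtain ⟨i, hi⟩ := Finset.card_eq_one.1 (show (U \ S).card = 1 by
          rw [Finset.card_sdiff_of_subset hS.1]; omega)
        have hiU : i ∈ U \ S := by rw [hi]; simp
        rw [Finset.mem_sdiff] at hiU
        refine ⟨i, hiU.1, ?_⟩
        symm
        apply Finset.eq_of_subset_of_card_le
        · intro x hx
          refine Finset.mem_erase.2 ⟨?_, hS.1 hx⟩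
          rintro rfl
          exact hiU.2 hx
        · rw [Finset.card_erase_of_mem hiU.1]; omega
      · intro i hi
        rw [Finset.mul_sum]
        refine Finset.sum_congr rfl fun m _ => ?_
        rw [mul_smul_comm, ← mul_assoc, hηe i hi, smul_mul_assoc, smul_smul, mul_comm]
    · intro S _ hS
      rw [Finset.mul_sum]
      refine Finset.sum_eq_zero fun m _ => ?_
      rw [mul_smul_comm, ← mul_assoc, wf_mul_not_disj G hG, zero_mul, smul_zero]
      intro hd
      apply hS
      rw [Finset.mem_powersetCard]
      refine ⟨?_, by simp_all⟩
      intro x hx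
      by_contra hxU
      exact Finset.disjoint_left.1 hd (Finset.mem_compl.2 hxU) hx
  have h3 : (ε * a U) • wf G f Finset.univ + ∑ i : Fin d, ∑ m,
      (if i.succ ∈ U then η i.succ * c (U.erase i.succ) m else 0) •
        (wf G f (Finset.univ.erase i.succ) * G (h m)) = 0 := by
    have aux : ∀ g : Fin (d + 1) → A, ∑ i ∈ U, g i = ∑ i, if i ∈ U then g i else 0 := by
      intro g; simp
    have := congrArg (fun z => wf G f Uᶜ * z) hrel
    simp only [mul_add, mul_zero] at this
    rw [h1, h2, aux, Fin.sum_univ_succ] at this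
    rw [← this]
    congr 1
    have hz : (if (0 : Fin (d+1)) ∈ U then ∑ m, (η 0 * c (U.erase 0) m) •
        (wf G f (Finset.univ.erase 0) * G (h m)) else 0) = 0 := by
      split_ifs with hh
      · exact Finset.sum_eq_zero fun m _ => by rw [h0 hh m]; simp
      · rfl
    rw [hz, zero_add]
    refine Finset.sum_congr rfl fun i _ => ?_
    split_ifs <;> simp
  rw [Fintype.linearIndependent_iff] at H
  have H' := H (fun x => x.elim (ε * a U) (fun q =>
    if q.1.succ ∈ U then η q.1.succ * c (U.erase q.1.succ) q.2 else 0)) (by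
      rw [Fintype.sum_option]
      rw [← h3]
      congr 1
      rw [Fintype.sum_prod_type]
      rfl)
  refine ⟨?_, ?_⟩
  · have := H' none
    simpa [hε] using this
  · intro i hi m
    refine Fin.cases (fun hi => h0 hi m) (fun j hj => ?_) i hi
    have := H' (some (j, m))
    simpa [hη, hj] using this

lemma key_indep {d k : ℕ} (hk : k < d) {M : Type*} [Fintype M]
    (G : V →ₗ[ℝ] A) (hG : ∀ x, G x * G x = 0) (f : Fin (d + 1) → V) (h : M → V)
    (H : LinearIndependent ℝ (fun x : Option (Fin d × M) => x.elim (wf G f Finset.univ)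
      (fun q => wf G f (Finset.univ.erase q.1.succ) * G (h q.2)))) :
    LinearIndependent ℝ (fun x : ((Finset.univ : Finset (Fin (d+1))).powersetCard (k + 1)) ⊕
      (((Finset.univ : Finset (Fin (d+1))).powersetCard k) × M) =>
      Sum.elim (fun S => wf G f S.1) (fun q => wf G f q.1.1 * G (h q.2)) x) := by
  classical
  rw [Fintype.linearIndependent_iff]
  intro w hw
  set a : Finset (Fin (d + 1)) → ℝ := fun S =>
    if hS : S ∈ (Finset.univ : Finset (Fin (d+1))).powersetCard (k + 1) then w (Sum.inl ⟨S, hS⟩)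
    else 0 with ha
  set c : Finset (Fin (d + 1)) → M → ℝ := fun S m =>
    if hS : S ∈ (Finset.univ : Finset (Fin (d+1))).powersetCard k then w (Sum.inr (⟨S, hS⟩, m))
    else 0 with hc
  have hrel : ∑ S ∈ Finset.univ.powersetCard (k + 1), a S • wf G f S
      + ∑ S ∈ Finset.univ.powersetCard k, ∑ m, c S m • (wf G f S * G (h m)) = 0 := by
    rw [← hw, Fintype.sum_sum_type, Fintype.sum_prod_type, ← Finset.sum_coe_sort,
      ← Finset.sum_coe_sort (Finset.univ.powersetCard k)]
    congr 1
    · refine Finset.sum_congr rfl fun S _ => ?_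
      simp only [ha, Sum.elim_inl]
      rw [dif_pos S.2]
    · refine Finset.sum_congr rfl fun S _ => Finset.sum_congr rfl fun m _ => ?_
      simp only [hc, Sum.elim_inr]
      rw [dif_pos S.2]
  have step := key_step G hG f h H a c hrel
  have c1 : ∀ S : Finset (Fin (d+1)), S.card = k → 0 ∉ S → ∀ m, c S m = 0 := by
    intro S hS h0 m
    have : (insert 0 S).card < (Finset.univ : Finset (Fin (d+1))).card := by
      rw [Finset.card_insert_of_notMem h0]; simp; omega
    obtain ⟨i, -, hi⟩ := Finset.exists_mem_notMem_of_card_lt_card this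
    rw [Finset.mem_insert, not_or] at hi
    have := (step (insert i S) (by rw [Finset.card_insert_of_notMem hi.2, hS])
      (fun hh => by
        rw [Finset.mem_insert] at hh
        exact absurd hh (by rintro (hh | hh); exacts [hi.1 hh.symm, h0 hh]))).2 i
        (Finset.mem_insert_self _ _) m
    rwa [Finset.erase_insert hi.2] at this
  have step2 : ∀ U : Finset (Fin (d+1)), U.card = k + 1 →
      a U = 0 ∧ ∀ i ∈ U, ∀ m, c (U.erase i) m = 0 := by
    intro U hU
    refine step U hU fun h0 m => c1 _ ?_ (by simp) m
    rw [Finset.card_erase_of_mem h0]; omega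
  rintro (⟨S, hS⟩ | ⟨⟨S, hS⟩, m⟩)
  · have := (step2 S (Finset.mem_powersetCard.1 hS).2).1
    simp only [ha] at this
    rwa [dif_pos hS] at this
  · have hcS := (Finset.mem_powersetCard.1 hS).2
    have : S.card < (Finset.univ : Finset (Fin (d+1))).card := by simp; omega
    obtain ⟨i, -, hi⟩ := Finset.exists_mem_notMem_of_card_lt_card this
    have := (step2 (insert i S) (by rw [Finset.card_insert_of_notMem hi, hcS])).2 i
      (Finset.mem_insert_self _ _) m
    rw [Finset.erase_insert hi] at this
    simp only [hc] at this
    rwa [dif_pos hS] at this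

end WedgeAlgebra

section Restriction

variable {n d : ℕ} {Φ : Type*}

/-- Restriction of vectors in `ℝ^n` to the coordinates of each simplex, in the product of
exterior algebras. -/
noncomputable def GG (e : Φ → Fin (d + 1) → Fin n) :
    (Fin n → ℝ) →ₗ[ℝ] (Φ → ExteriorAlgebra ℝ (Fin (d + 1) → ℝ)) :=
  LinearMap.pi fun φ => ExteriorAlgebra.ι ℝ ∘ₗ LinearMap.funLeft ℝ ℝ (e φ)

lemma GG_sq (e : Φ → Fin (d + 1) → Fin n) (x : Fin n → ℝ) : GG e x * GG e x = 0 := by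
  ext φ
  simp [GG]

/-- The determinants of the restrictions. -/
noncomputable def RR (e : Φ → Fin (d + 1) → Fin n) :
    (Fin n → ℝ) [⋀^Fin (d + 1)]→ₗ[ℝ] (Φ → ℝ) :=
  AlternatingMap.pi fun φ =>
    (Matrix.detRowAlternating (n := Fin (d + 1)) (R := ℝ)).compLinearMap
      (LinearMap.funLeft ℝ ℝ (e φ))

lemma RR_apply (e : Φ → Fin (d + 1) → Fin n) (u : Fin (d + 1) → Fin n → ℝ) (φ : Φ) :
    RR e u φ = Matrix.det (Matrix.of fun i j => u i (e φ j)) := rfl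

lemma exists_delta (e : Φ → Fin (d + 1) → Fin n) :
    ∃ δ : (Φ → ExteriorAlgebra ℝ (Fin (d + 1) → ℝ)) →ₗ[ℝ] (Φ → ℝ),
      ∀ u : Fin (d + 1) → Fin n → ℝ, δ (wp (GG e) (List.ofFn u)) = RR e u := by
  classical
  let D : ∀ i, (Fin (d + 1) → ℝ) [⋀^Fin i]→ₗ[ℝ] ℝ := fun i =>
    if h : i = d + 1 then h ▸ (Matrix.detRowAlternating (n := Fin (d + 1)) (R := ℝ)) else 0
  have hD : D (d + 1) = Matrix.detRowAlternating := by simp [D]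
  refine ⟨LinearMap.pi fun φ => ExteriorAlgebra.liftAlternating D ∘ₗ LinearMap.proj φ, ?_⟩
  intro u
  ext φ
  have h1 : wp (GG e) (List.ofFn u) φ =
      ExteriorAlgebra.ιMulti ℝ (d + 1) (fun i => LinearMap.funLeft ℝ ℝ (e φ) (u i)) := by
    rw [ExteriorAlgebra.ιMulti_apply, wp, Pi.list_prod_apply, List.map_map, List.map_ofFn]
    rfl
  rw [LinearMap.pi_apply, LinearMap.comp_apply, LinearMap.proj_apply, h1,
    ExteriorAlgebra.liftAlternating_apply_ιMulti, hD]
  rfl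

lemma wp_GG_zero (e : Φ → Fin (d + 1) → Fin n) (t : List (Fin n))
    (h : ¬ ∃ φ, ∀ v ∈ t, v ∈ Set.range (e φ)) :
    wp (GG e) (t.map fun v => Pi.single v (1 : ℝ)) = 0 := by
  push Not at h
  ext φ
  obtain ⟨v, hv, hv'⟩ := h φ
  rw [wp, Pi.list_prod_apply, Pi.zero_apply]
  apply List.prod_eq_zero
  rw [List.mem_map]
  refine ⟨GG e (Pi.single v 1), ?_, ?_⟩
  · rw [List.mem_map]
    exact ⟨_, List.mem_map.2 ⟨v, hv, rfl⟩, rfl⟩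
  · have : LinearMap.funLeft ℝ ℝ (e φ) (Pi.single v 1) = 0 := by
      ext j
      rw [LinearMap.funLeft_apply, Pi.single_apply, if_neg]
      · rfl
      · intro hh; exact hv' ⟨j, hh⟩
    simp [GG, this]

lemma card_le_faces {J : Type*} [Fintype J] {k : ℕ} (e : Φ → Fin (d + 1) → Fin n)
    (X : J → Φ → ExteriorAlgebra ℝ (Fin (d + 1) → ℝ)) (hX : LinearIndependent ℝ X)
    (hl : ∀ j, ∃ l : List (Fin n → ℝ), l.length = k ∧ X j = wp (GG e) l)
    (K : Finset (Finset (Fin n)))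
    (hK : ∀ τ : Finset (Fin n), τ.card = k → (∃ φ, ∀ v ∈ τ, v ∈ Set.range (e φ)) → τ ∈ K) :
    Fintype.card J ≤ K.card := by
  classical
  let E : Fin n → Fin n → ℝ := fun v => Pi.single v (1 : ℝ)
  have hE : ⊤ ≤ Submodule.span ℝ (Set.range E) := by
    have := (Pi.basisFun ℝ (Fin n)).span_eq
    rw [← this]
    apply Submodule.span_mono
    rintro _ ⟨v, rfl⟩
    exact ⟨v, by simp [E]⟩
  let Y : K → Φ → ExteriorAlgebra ℝ (Fin (d + 1) → ℝ) := fun τ => wf (GG e) E τ.1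
  have hXY : ∀ j, X j ∈ Submodule.span ℝ (Set.range Y) := by
    intro j
    obtain ⟨l, hlk, hXl⟩ := hl j
    rw [hXl]
    refine Submodule.span_le.2 ?_ (wp_mem_span (GG e) E hE l)
    rintro _ ⟨t, ht, rfl⟩
    by_cases hnd : t.Nodup
    · by_cases hf : ∃ φ, ∀ v ∈ t, v ∈ Set.range (e φ)
      · have hm : t.toFinset ∈ K := by
          apply hK
          · rw [List.toFinset_card_of_nodup hnd, ht, hlk]
          · simpa using hf
        have hp : (t.map E).Perm (t.toFinset.toList.map E) :=
          ((List.toFinset_toList hnd).symm).map E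
        obtain ⟨ε, -, h⟩ := wp_perm (GG e) (GG_sq e) hp
        rw [h]
        exact Submodule.smul_mem _ _ (Submodule.subset_span ⟨⟨_, hm⟩, rfl⟩)
      · rw [wp_GG_zero e t hf]
        exact Submodule.zero_mem _
    · rw [wp_dup (GG e) (GG_sq e)]
      · exact Submodule.zero_mem _
      · intro hh
        exact hnd (List.Nodup.of_map _ hh)
  have h1 : Submodule.span ℝ (Set.range X) ≤ Submodule.span ℝ (Set.range Y) := by
    rw [Submodule.span_le]
    rintro _ ⟨j, rfl⟩
    exact hXY j
  have : Module.Finite ℝ (Submodule.span ℝ (Set.range Y)) :=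
    FiniteDimensional.span_of_finite ℝ (Set.finite_range Y)
  calc Fintype.card J = Module.finrank ℝ (Submodule.span ℝ (Set.range X)) :=
        (finrank_span_eq_card hX).symm
    _ ≤ Module.finrank ℝ (Submodule.span ℝ (Set.range Y)) := Submodule.finrank_mono h1
    _ ≤ Fintype.card K := finrank_range_le_card Y
    _ = K.card := Fintype.card_coe K

/-- Top-degree independence from the spanning property. -/
lemma top_indep [Fintype Φ] {M : Type*} [Fintype M] (e : Φ → Fin (d + 1) → Fin n)
    (f : Fin (d + 1) → Fin n → ℝ) (h : M → Fin n → ℝ)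
    (hspan : ⊤ ≤ Submodule.span ℝ (Set.range (Sum.elim f h)))
    (hsurj : ∀ y : Φ → ℝ, ∃ q : Fin d → Fin n → ℝ,
      ∑ i : Fin d, RR e (Function.update f i.succ (q i)) = y)
    (hcard : Fintype.card Φ = d * Fintype.card M + 1) :
    LinearIndependent ℝ (fun x : Option (Fin d × M) => x.elim (wf (GG e) f Finset.univ)
      (fun q => wf (GG e) f (Finset.univ.erase q.1.succ) * (GG e) (h q.2))) := by
  classical
  obtain ⟨δ, hδ⟩ := exists_delta e
  apply LinearIndependent.of_comp δ
  apply linearIndependent_of_top_le_span_of_card_eq_finrank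
  · set W := Submodule.span ℝ (Set.range (δ ∘ (fun x : Option (Fin d × M) =>
      x.elim (wf (GG e) f Finset.univ)
      (fun q => wf (GG e) f (Finset.univ.erase q.1.succ) * (GG e) (h q.2))))) with hW
    have hf : RR e f ∈ W := by
      have hp : (List.ofFn f).Perm ((Finset.univ : Finset (Fin (d+1))).toList.map f) := by
        rw [List.ofFn_eq_map]
        apply List.Perm.map
        rw [List.perm_ext_iff_of_nodup (List.nodup_finRange _) (Finset.nodup_toList _)]
        simp
      obtain ⟨ε, -, he⟩ := wp_perm (GG e) (GG_sq e) hp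
      rw [← hδ, he, map_smul]
      exact Submodule.smul_mem _ _ (Submodule.subset_span ⟨none, rfl⟩)
    have hm : ∀ (i : Fin d) (m : M), RR e (Function.update f i.succ (h m)) ∈ W := by
      intro i m
      have hp : (List.ofFn (Function.update f i.succ (h m))).Perm
          (((Finset.univ : Finset (Fin (d+1))).erase i.succ).toList.map f ++ [h m]) := by
        have h1 : ((Finset.univ : Finset (Fin (d+1))).erase i.succ).toList.map f ++ [h m] =
            (((Finset.univ : Finset (Fin (d+1))).erase i.succ).toList ++ [i.succ]).map
              (Function.update f i.succ (h m)) := by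
          rw [List.map_append]
          congr 1
          · apply List.map_congr_left
            intro a ha
            rw [Finset.mem_toList, Finset.mem_erase] at ha
            rw [Function.update_of_ne ha.1]
          · simp
        rw [h1, List.ofFn_eq_map]
        apply List.Perm.map
        rw [List.perm_ext_iff_of_nodup (List.nodup_finRange _)]
        · intro a
          simp
          tauto
        · rw [List.nodup_append']
          refine ⟨Finset.nodup_toList _, by simp, ?_⟩
          intro a ha hb
          simp_all
      obtain ⟨ε, -, he⟩ := wp_perm (GG e) (GG_sq e) hp
      rw [← hδ, he, map_smul]
      refine Submodule.smul_mem _ _ (Submodule.subset_span ⟨some (i, m), ?_⟩)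
      simp [wf, wp]
    have hv : ∀ (i : Fin d) (v : Fin n → ℝ), RR e (Function.update f i.succ v) ∈ W := by
      intro i v
      have : Submodule.span ℝ (Set.range (Sum.elim f h)) ≤
          W.comap ((RR e).toMultilinearMap.toLinearMap f i.succ) := by
        rw [Submodule.span_le]
        rintro _ ⟨j | m, rfl⟩
        · change RR e (Function.update f i.succ (f j)) ∈ W
          by_cases hj : j = i.succ
          · rw [hj, Function.update_eq_self]
            exact hf
          · rw [AlternatingMap.map_update_self _ _ (Ne.symm hj)]
            exact Submodule.zero_mem _
        · exact hm i m
      exact this (hspan trivial)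
    intro y _
    obtain ⟨q, rfl⟩ := hsurj y
    exact Submodule.sum_mem _ fun i _ => hv i _
  · simp [hcard]

lemma card_bound [Fintype Φ] {M : Type*} [Fintype M] (e : Φ → Fin (d + 1) → Fin n)
    (f : Fin (d + 1) → Fin n → ℝ) (h : M → Fin n → ℝ)
    (hspan : ⊤ ≤ Submodule.span ℝ (Set.range (Sum.elim f h)))
    (hsurj : ∀ y : Φ → ℝ, ∃ q : Fin d → Fin n → ℝ,
      ∑ i : Fin d, RR e (Function.update f i.succ (q i)) = y)
    (hcard : Fintype.card Φ = d * Fintype.card M + 1) {k : ℕ} (hk : k < d)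
    (K : Finset (Finset (Fin n)))
    (hK : ∀ τ : Finset (Fin n), τ.card = k + 1 →
      (∃ φ, ∀ v ∈ τ, v ∈ Set.range (e φ)) → τ ∈ K) :
    (d + 1).choose (k + 1) + (d + 1).choose k * Fintype.card M ≤ K.card := by
  have H := top_indep e f h hspan hsurj hcard
  have H2 := key_indep hk (GG e) (GG_sq e) f h H
  have := card_le_faces e _ H2 (k := k + 1) ?_ K hK
  · simpa using this
  · rintro (⟨S, hS⟩ | ⟨⟨S, hS⟩, m⟩)
    · exact ⟨S.toList.map f, by simpa using hS, rfl⟩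
    · refine ⟨S.toList.map f ++ [h m], by simpa using hS, ?_⟩
      simp [wf, wp]

end Restriction

section Analysis

/-- The coordinate rows of a configuration, with the all-ones row first. -/
def rowsOf {n d : ℕ} (p : Fin n → Fin d → ℝ) : Fin (d + 1) → Fin n → ℝ :=
  Fin.cons (fun _ => 1) fun i v => p v i

/-- The determinant as a continuous multilinear map of the rows. -/
noncomputable def detC (m : ℕ) : ContinuousMultilinearMap ℝ (fun _ : Fin m => Fin m → ℝ) ℝ :=
  { (Matrix.detRowAlternating (n := Fin m) (R := ℝ)).toMultilinearMap with
    cont := by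
      change Continuous fun A : Matrix (Fin m) (Fin m) ℝ => A.det
      exact Continuous.matrix_det continuous_id }

lemma detC_apply (m : ℕ) (A : Fin m → Fin m → ℝ) : detC m A = Matrix.det (Matrix.of A) := rfl

lemma vol_eq {n d : ℕ} (σ : Finset (Fin n)) (h : σ.card = d + 1) (p : Fin n → Fin d → ℝ) :
    vol d σ p = detC (d + 1) (fun i j => rowsOf p i (σ.orderEmbOfFin h j)) := by
  rw [vol, dif_pos h, detC_apply]
  congr 1
  ext i j
  refine Fin.cases ?_ (fun i => ?_) i <;> simp [rowsOf]

lemma rowsOf_contDiff {n d : ℕ} (s : Fin (d + 1) → Fin n) :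
    ContDiff ℝ ⊤ (fun (p : Fin n → Fin d → ℝ) (i : Fin (d + 1)) (j : Fin (d + 1)) =>
      rowsOf p i (s j)) := by
  rw [contDiff_pi]
  intro i
  rw [contDiff_pi]
  intro j
  refine Fin.cases ?_ (fun i => ?_) i
  · simp only [rowsOf, Fin.cons_zero]; exact contDiff_const
  · simp only [rowsOf, Fin.cons_succ]; fun_prop

lemma vol_contDiff {n d : ℕ} (σ : Finset (Fin n)) (h : σ.card = d + 1) :
    ContDiff ℝ ⊤ (vol d σ) := by
  rw [funext (vol_eq σ h)]
  exact (detC (d + 1)).contDiff.comp (rowsOf_contDiff _)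

lemma vol_fderiv {n d : ℕ} (σ : Finset (Fin n)) (h : σ.card = d + 1) (p q : Fin n → Fin d → ℝ) :
    fderiv ℝ (vol d σ) p q = ∑ i : Fin d, Matrix.det (Matrix.of fun a j =>
      (Function.update (rowsOf p) i.succ (fun v => q v i)) a (σ.orderEmbOfFin h j)) := by
  set s := σ.orderEmbOfFin h with hs
  have hr : HasFDerivAt (fun (p : Fin n → Fin d → ℝ) (i : Fin (d + 1)) (j : Fin (d + 1)) =>
      rowsOf p i (s j)) (ContinuousLinearMap.pi fun i => ContinuousLinearMap.pi fun j =>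
        (Fin.cases 0 (fun i' => (ContinuousLinearMap.proj (R := ℝ) (φ := fun _ : Fin d => ℝ) i').comp
          (ContinuousLinearMap.proj (R := ℝ) (φ := fun _ : Fin n => Fin d → ℝ) (s j))) i :
            (Fin n → Fin d → ℝ) →L[ℝ] ℝ)) p := by
    rw [hasFDerivAt_pi]
    intro i
    rw [hasFDerivAt_pi]
    intro j
    refine Fin.cases ?_ (fun i => ?_) i
    · simp only [rowsOf, Fin.cons_zero, Fin.cases_zero]
      exact hasFDerivAt_const _ _
    · simp only [rowsOf, Fin.cons_succ, Fin.cases_succ]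
      exact ((ContinuousLinearMap.proj (R := ℝ) (φ := fun _ : Fin d => ℝ) i).comp
          (ContinuousLinearMap.proj (R := ℝ) (φ := fun _ : Fin n => Fin d → ℝ) (s j))).hasFDerivAt
  have hD := ((detC (d + 1)).hasFDerivAt (fun i j => rowsOf p i (s j))).comp p hr
  have hv : vol d σ = (detC (d + 1)) ∘ (fun (p : Fin n → Fin d → ℝ) (i : Fin (d + 1))
      (j : Fin (d + 1)) => rowsOf p i (s j)) := funext (vol_eq σ h)
  rw [hv, hD.fderiv, ContinuousLinearMap.comp_apply, ContinuousMultilinearMap.linearDeriv_apply,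
    Fin.sum_univ_succ]
  have hz : detC (d + 1) (Function.update (fun i j => rowsOf p i (s j)) 0 0) = 0 :=
    (detC (d + 1)).map_coord_zero 0 (by simp)
  refine (congrArg₂ (· + ·) hz rfl).trans ?_
  rw [zero_add]
  refine Finset.sum_congr rfl fun i _ => ?_
  rw [detC_apply]
  congr 2
  ext a j
  by_cases ha : a = i.succ
  · subst ha; simp
  · simp [Function.update_of_ne ha]

lemma surj_of_indep {Φ E : Type*} [Fintype Φ] [NormedAddCommGroup E] [NormedSpace ℝ E]
    (L : Φ → E →L[ℝ] ℝ) (hL : LinearIndependent ℝ L) (y : Φ → ℝ) : ∃ q, ∀ φ, L φ q = y φ := by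
  classical
  let T : E →ₗ[ℝ] (Φ → ℝ) := LinearMap.pi fun φ => (L φ : E →ₗ[ℝ] ℝ)
  have hT : LinearMap.range T = ⊤ := by
    by_contra hne
    obtain ⟨g, hg, hle⟩ := Submodule.exists_le_ker_of_lt_top _ (lt_top_iff_ne_top.2 hne)
    rw [Fintype.linearIndependent_iff] at hL
    have hgg : ∀ z : Φ → ℝ, g z = ∑ φ, z φ * g (Pi.single φ 1) := by
      intro z
      conv_lhs => rw [pi_eq_sum_univ' z]
      rw [map_sum]
      refine Finset.sum_congr rfl fun φ _ => ?_
      rw [map_smul, smul_eq_mul]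
    have := hL (fun φ => g (Pi.single φ 1)) (by
      ext x
      have h1 : g (T x) = 0 := hle ⟨x, rfl⟩
      rw [hgg] at h1
      rw [zero_apply, ← h1, sum_apply]
      refine Finset.sum_congr rfl fun φ _ => ?_
      simp [T, mul_comm])
    apply hg
    ext z
    simp [this]
  obtain ⟨q, hq⟩ := LinearMap.range_eq_top.1 hT y
  exact ⟨q, fun φ => congrFun hq φ⟩

lemma exists_good {n d : ℕ} (F : Finset (Finset (Fin n)))
    (hcard : ∀ σ ∈ F, σ.card = d + 1) (hne : F.Nonempty)
    (hindep : ∃ p : Fin n → Fin d → ℝ,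
      LinearIndependent ℝ fun σ : F => fderiv ℝ (vol d σ.1) p) :
    ∃ p : Fin n → Fin d → ℝ,
      (LinearIndependent ℝ fun σ : F => fderiv ℝ (vol d σ.1) p) ∧
      LinearIndependent ℝ (rowsOf p) := by
  obtain ⟨p, hp⟩ := hindep
  obtain ⟨σ, hσ⟩ := hne
  have hc : Continuous fun p : Fin n → Fin d → ℝ => fun σ : F => fderiv ℝ (vol d σ.1) p :=
    continuous_pi fun σ => (vol_contDiff σ.1 (hcard _ σ.2)).continuous_fderiv (by simp)
  have hev : ∀ᶠ p' in nhds p, LinearIndependent ℝ fun σ : F => fderiv ℝ (vol d σ.1) p' :=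
    hc.continuousAt.eventually (hp.eventually)
  have hfr : ∃ᶠ p' in nhds p, vol d σ p' ≠ 0 := by
    intro hev0
    have h0 : vol d σ =ᶠ[nhds p] fun _ => (0 : ℝ) := by
      filter_upwards [hev0] with x hx
      exact not_not.1 hx
    have := h0.fderiv_eq (𝕜 := ℝ)
    exact hp.ne_zero ⟨σ, hσ⟩ (by simpa using this)
  obtain ⟨p', h1, h2⟩ := (hfr.and_eventually hev).exists
  refine ⟨p', h2, ?_⟩
  rw [vol_eq σ (hcard σ hσ), detC_apply] at h1
  exact (Matrix.linearIndependent_rows_of_det_ne_zero h1).of_comp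
    (LinearMap.funLeft ℝ ℝ (σ.orderEmbOfFin (hcard σ hσ)))

end Analysis

lemma exists_extension {n d : ℕ} (f : Fin (d + 1) → Fin n → ℝ) (hf : LinearIndependent ℝ f) :
    ∃ h : Fin (n - d - 1) → Fin n → ℝ,
      ⊤ ≤ Submodule.span ℝ (Set.range (Sum.elim f h)) := by
  classical
  set W := Submodule.span ℝ (Set.range f) with hW
  obtain ⟨C, hC⟩ := Submodule.exists_isCompl W
  have h1 : Module.finrank ℝ W = d + 1 := by rw [hW, finrank_span_eq_card hf]; simp
  have h2 := Submodule.finrank_add_eq_of_isCompl hC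
  have h3 : Module.finrank ℝ C = n - d - 1 := by simp at h2; omega
  let b := Module.finBasisOfFinrankEq ℝ C h3
  refine ⟨fun m => (b m : Fin n → ℝ), ?_⟩
  rw [Set.Sum.elim_range, Submodule.span_union]
  have h4 : Submodule.span ℝ (Set.range fun m => (b m : Fin n → ℝ)) = C := by
    have := congrArg (Submodule.map C.subtype) b.span_eq
    rw [Submodule.map_span, Submodule.map_top, Submodule.range_subtype, ← Set.range_comp] at this
    exact this
  rw [h4, ← hW, hC.sup_eq_top]

lemma hockey (k : ℕ) : ∀ d, k < d →
    ∑ l ∈ Finset.range (k + 1), (d - l).choose (k - l) = (d + 1).choose k := by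
  induction k with
  | zero => intro d _; simp
  | succ k ih =>
    intro d hd
    obtain ⟨d, rfl⟩ : ∃ d', d = d' + 1 := ⟨d - 1, by omega⟩
    rw [Finset.sum_range_succ']
    have := ih d (by omega)
    simp only [Nat.add_sub_add_right, Nat.sub_zero]
    rw [this, Nat.choose_succ_succ (d + 1) k]

/-- Face-number lower bound for bases of the `d`-volume rigidity matroid. -/
theorem face_count_lower_bound (d n : ℕ) (hd : 1 ≤ d) (hn : d + 1 ≤ n)
    (F : Finset (Finset (Fin n)))
    (hcard : ∀ σ ∈ F, σ.card = d + 1)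
    (hsize : F.card = d * n - (d ^ 2 + d - 1))
    (hindep : ∃ p : Fin n → Fin d → ℝ,
      LinearIndependent ℝ fun σ : F => fderiv ℝ (vol d σ.1) p) :
    ∀ k ≤ d,
      (d + 1).choose (k + 1)
          + ∑ l ∈ Finset.range d,
              (if l ≤ k then (n - d - 1) * (d - l).choose (k - l) else 0)
        ≤ (((Finset.univ : Finset (Fin n)).powersetCard (k + 1)).filter
            fun τ => ∃ σ ∈ F, τ ⊆ σ).card := by
  intro k hk
  have hF : F.card = d * (n - d - 1) + 1 := by
    obtain ⟨m, rfl⟩ := Nat.exists_eq_add_of_le hn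
    rw [hsize]
    have e1 : d + 1 + m - d - 1 = m := by omega
    have e2 : d * (d + 1 + m) = d ^ 2 + d + d * m := by ring
    rw [e1, e2]
    omega
  rcases hk.eq_or_lt with rfl | hk
  · have h1 : ∑ l ∈ Finset.range k, (if l ≤ k then (n - k - 1) * (k - l).choose (k - l) else 0)
        = k * (n - k - 1) := by
      rw [Finset.sum_congr rfl (g := fun _ => n - k - 1)]
      · simp
      · intro l hl
        rw [Finset.mem_range] at hl
        rw [if_pos hl.le]; simp
    rw [h1, Nat.choose_self, add_comm, ← hF]
    apply Finset.card_le_card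
    intro σ hσ
    simp only [Finset.mem_filter, Finset.mem_powersetCard]
    exact ⟨⟨Finset.subset_univ _, hcard σ hσ⟩, σ, hσ, subset_rfl⟩
  · have h1 : ∑ l ∈ Finset.range d, (if l ≤ k then (n - d - 1) * (d - l).choose (k - l) else 0)
        = (d + 1).choose k * (n - d - 1) := by
      rw [← hockey k d hk, Finset.sum_mul, ← Finset.sum_filter]
      have : (Finset.range d).filter (fun l => l ≤ k) = Finset.range (k + 1) := by
        ext l; simp; omega
      rw [this]
      exact Finset.sum_congr rfl fun l _ => mul_comm _ _
    rw [h1]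
    obtain ⟨p, hp, hf⟩ := exists_good F hcard (Finset.card_pos.1 (by omega)) hindep
    obtain ⟨h, hspan⟩ := exists_extension (rowsOf p) hf
    have := card_bound (d := d) (n := n) (Φ := F)
      (fun σ j => σ.1.orderEmbOfFin (hcard σ.1 σ.2) j) (rowsOf p) h hspan ?_ ?_ hk
      (((Finset.univ : Finset (Fin n)).powersetCard (k + 1)).filter
            fun τ => ∃ σ ∈ F, τ ⊆ σ) ?_
    · simpa using this
    · intro y
      obtain ⟨q, hq⟩ := surj_of_indep _ hp y
      refine ⟨fun i v => q v i, ?_⟩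
      ext σ
      rw [← hq σ, vol_fderiv σ.1 (hcard σ.1 σ.2), Finset.sum_apply]
      rfl
    · simp [hF]
    · rintro τ hτ ⟨σ, hσ⟩
      simp only [Finset.mem_filter, Finset.mem_powersetCard]
      refine ⟨⟨Finset.subset_univ _, hτ⟩, σ.1, σ.2, ?_⟩
      intro v hv
      obtain ⟨j, rfl⟩ := hσ v hv
      exact Finset.orderEmbOfFin_mem _ _ _
end

section
/- Let d ≥ 1, n ≥ d+1, let F be a family of (d+1)-element subsets of {1,…,n}, and let p : Fin n → (Fin d → ℝ) be a generic configuration. Say that (F, p) is locally d-volume rigid if there is an open neighbourhood U of p in the space of configurations such that every q ∈ U with vol_σ(q) = vol_σ(p) for all σ ∈ F satisfies vol_τ(q) = vol_τ(p) for all (d+1)-element subsets τ of {1,…,n}. Then (F, p) is locally d-volume rigid if and only if F contains a subset B with |B| = d·n − (d²+d−1) such that the gradients ∇vol_σ(p), σ ∈ B, are linearly independent (i.e. F contains a basis of the d-volume rigidity matroid R_n^d). -/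
/-- A configuration `p : Fin n → Fin d → ℝ` is generic if every nonzero polynomial with
rational coefficients in the `d·n` coordinate variables is nonzero at the coordinates
of `p`. -/
def IsGeneric {n : ℕ} (d : ℕ) (p : Fin n → Fin d → ℝ) : Prop :=
  ∀ f : MvPolynomial (Fin n × Fin d) ℚ, f ≠ 0 →
    (MvPolynomial.aeval fun v : Fin n × Fin d => p v.1 v.2) f ≠ 0

/-- `(F, p)` is locally `d`-volume rigid: some open neighbourhood `U` of `p` is such that
every `q ∈ U` whose signed volumes agree with those of `p` on every member of `F` has all
its signed `d`-volumes equal to those of `p`. -/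
def LocallyRigid {n : ℕ} (d : ℕ) (F : Finset (Finset (Fin n)))
    (p : Fin n → Fin d → ℝ) : Prop :=
  ∃ U : Set (Fin n → Fin d → ℝ), IsOpen U ∧ p ∈ U ∧
    ∀ q ∈ U, (∀ σ ∈ F, vol d σ q = vol d σ p) →
      ∀ τ : Finset (Fin n), τ.card = d + 1 → vol d τ q = vol d τ p


namespace VR
open MvPolynomial

abbrev Cfg (n d : ℕ) := Fin n → Fin d → ℝ

noncomputable def ev {n d : ℕ} (q : Cfg n d) : MvPolynomial (Fin n × Fin d) ℚ →ₐ[ℚ] ℝ :=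
  aeval fun v : Fin n × Fin d => q v.1 v.2

noncomputable def Dm {n d : ℕ} (g : Fin (d + 1) → Fin n) (q : Cfg n d) :
    Matrix (Fin (d + 1)) (Fin (d + 1)) ℝ :=
  Matrix.of (Fin.cons (fun _ => (1 : ℝ)) fun i j => q (g j) i)

noncomputable def Pm {n d : ℕ} (g : Fin (d + 1) → Fin n) :
    Matrix (Fin (d + 1)) (Fin (d + 1)) (MvPolynomial (Fin n × Fin d) ℚ) :=
  Matrix.of (Fin.cons (fun _ => 1) fun i j => X (g j, i))

lemma ev_Pm {n d : ℕ} (g : Fin (d + 1) → Fin n) (q : Cfg n d) :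
    ev q (Pm g).det = (Dm g q).det := by
  rw [AlgHom.map_det]
  congr 1
  ext a k
  refine Fin.cases ?_ (fun i => ?_) a <;> simp [Pm, Dm, ev]

/-- derivative of a polynomial function -/
noncomputable def gradP {n d : ℕ} (f : MvPolynomial (Fin n × Fin d) ℚ) (q : Cfg n d) :
    Cfg n d →L[ℝ] ℝ :=
  ∑ v : Fin n × Fin d, ev q (pderiv v f) •
    ((ContinuousLinearMap.proj v.2 : (Fin d → ℝ) →L[ℝ] ℝ).comp
      (ContinuousLinearMap.proj v.1 : Cfg n d →L[ℝ] (Fin d → ℝ)))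

lemma gradP_apply {n d : ℕ} (f : MvPolynomial (Fin n × Fin d) ℚ) (q x : Cfg n d) :
    gradP f q x = ∑ v : Fin n × Fin d, ev q (pderiv v f) * x v.1 v.2 := by
  simp [gradP]

lemma hasFDerivAt_ev {n d : ℕ} (f : MvPolynomial (Fin n × Fin d) ℚ) (q : Cfg n d) :
    HasFDerivAt (fun q : Cfg n d => ev q f) (gradP f q) q := by
  induction f using MvPolynomial.induction_on with
  | C a =>
    have : gradP (C a) q = 0 := by ext x; simp [gradP_apply]
    rw [this]
    simpa [ev] using hasFDerivAt_const (a : ℝ) q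
  | add f g hf hg =>
    have : gradP (f + g) q = gradP f q + gradP g q := by
      ext x; simp [gradP_apply, add_mul, Finset.sum_add_distrib]
    rw [this]
    refine (hf.add hg).congr_of_eventuallyEq (Filter.Eventually.of_forall fun x => ?_)
    simp
  | mul_X f v hf =>
    let π : Cfg n d →L[ℝ] ℝ := ((ContinuousLinearMap.proj v.2 : (Fin d → ℝ) →L[ℝ] ℝ).comp
      (ContinuousLinearMap.proj v.1 : Cfg n d →L[ℝ] (Fin d → ℝ)))
    have hπ : HasFDerivAt (fun q : Cfg n d => q v.1 v.2) π q := π.hasFDerivAt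
    have h := hf.mul hπ
    have e : gradP (f * X v) q = ev q f • π + q v.1 v.2 • gradP f q := by
      ext x
      have hX : ∀ w, ev q (X w) = q w.1 w.2 := fun w => by simp [ev]
      simp only [gradP_apply, Derivation.leibniz, smul_eq_mul, map_add, map_mul, add_mul,
        Finset.sum_add_distrib, _root_.add_apply, _root_.smul_apply, hX,
        pderiv_X, Finset.mul_sum]
      congr 1
      · rw [Finset.sum_eq_single v]
        · simp [π]
        · intro w _ hw; simp [hw.symm]
        · simp
      · exact Finset.sum_congr rfl fun w _ => by ring
    rw [e]
    refine h.congr_of_eventuallyEq (Filter.Eventually.of_forall fun x => ?_)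
    simp [ev]

lemma contDiff_ev {n d : ℕ} (f : MvPolynomial (Fin n × Fin d) ℚ) :
    ContDiff ℝ 1 (fun q : Cfg n d => ev q f) := by
  induction f using MvPolynomial.induction_on with
  | C a => simpa [ev] using contDiff_const
  | add f g hf hg => simpa using hf.add hg
  | mul_X f v hf =>
    have : ContDiff ℝ 1 (fun q : Cfg n d => q v.1 v.2) := by fun_prop
    simpa [ev] using hf.mul this

noncomputable def volP {n : ℕ} (d : ℕ) (σ : Finset (Fin n)) : MvPolynomial (Fin n × Fin d) ℚ :=
  if h : σ.card = d + 1 then (Pm (σ.orderEmbOfFin h)).det else 0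

lemma vol_eq {n d : ℕ} (σ : Finset (Fin n)) : vol d σ = fun q => ev q (volP d σ) := by
  funext q
  unfold vol volP
  split_ifs with h
  · rw [ev_Pm]; rfl
  · simp

lemma vol_eq_D {n d : ℕ} (σ : Finset (Fin n)) (h : σ.card = d + 1) (q : Cfg n d) :
    vol d σ q = (Dm (σ.orderEmbOfFin h) q).det := by
  unfold vol; rw [dif_pos h]; rfl

lemma D_eq_vol {n d : ℕ} (g : Fin (d + 1) → Fin n) (hg : Function.Injective g) :
    ∃ (σ : Finset (Fin n)) (ε : ℝ), σ.card = d + 1 ∧ ∀ q : Cfg n d, (Dm g q).det = ε * vol d σ q := by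
  classical
  have hc : (Finset.univ.image g).card = d + 1 := by
    rw [Finset.card_image_of_injective _ hg]; simp
  set σ := Finset.univ.image g with hσ
  have hex : ∀ k, ∃ l, σ.orderEmbOfFin hc l = g k := by
    intro k
    have : g k ∈ Set.range (σ.orderEmbOfFin hc) := by
      rw [Finset.range_orderEmbOfFin]; simp [hσ]
    exact this
  choose π hπ using hex
  have hinj : Function.Injective π := fun a b hab => hg (by rw [← hπ, ← hπ, hab])
  let P : Equiv.Perm (Fin (d + 1)) := Equiv.ofBijective π (Finite.injective_iff_bijective.1 hinj)
  refine ⟨σ, ((Equiv.Perm.sign P : ℤ) : ℝ), hc, fun q => ?_⟩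
  rw [vol_eq_D σ hc, ← Matrix.det_permute']
  congr 1
  ext a k
  have : σ.orderEmbOfFin hc (P k) = g k := hπ k
  refine Fin.cases ?_ (fun i => ?_) a <;> simp [Dm, this]

lemma gram {n d : ℕ} {B C : Type*} [Fintype B] [DecidableEq B] [Fintype C]
    (p : Cfg n d) (hp : IsGeneric d p)
    (N : Matrix B C (MvPolynomial (Fin n × Fin d) ℚ)) (s : C → MvPolynomial (Fin n × Fin d) ℚ)
    (hind : LinearIndependent ℝ (fun b c => ev p (N b c)))
    (hs : (fun c => ev p (s c)) ∈ Submodule.span ℝ (Set.range (fun b c => ev p (N b c)))) :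
    ∃ (m : MvPolynomial (Fin n × Fin d) ℚ) (x : B → MvPolynomial (Fin n × Fin d) ℚ),
      ev p m ≠ 0 ∧ ∀ c, m * s c = ∑ b, x b * N b c := by
  set M : Matrix B C ℝ := N.map (ev p) with hM
  have hli : LinearIndependent ℝ M.row := hind
  have hdet : (M * M.transpose).det ≠ 0 := by
    have h1 := M.rank_self_mul_transpose
    rw [hli.rank_matrix] at h1
    have h2 : LinearIndependent ℝ (M * M.transpose).row := by
      rw [linearIndependent_iff_card_eq_finrank_span, Set.finrank, ← Matrix.rank_eq_finrank_span_row, h1]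
    have := (Matrix.linearIndependent_rows_iff_isUnit.1 h2)
    exact ((Matrix.isUnit_iff_isUnit_det _).1 this).ne_zero
  refine ⟨(N * N.transpose).det, (N * N.transpose).adjugate.mulVec (N.mulVec s), ?_, ?_⟩
  · have : ev p (N * N.transpose).det = (M * M.transpose).det := by
      rw [AlgHom.map_det]; congr 1
      ext i j; simp [Matrix.mul_apply, hM]
    rwa [this]
  · intro c
    by_contra hne
    refine hp _ (sub_ne_zero.2 hne) ?_
    change ev p _ = 0
    obtain ⟨y, hy⟩ := (Submodule.mem_span_range_iff_exists_fun ℝ).1 hs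
    have hy' : (fun c => ev p (s c)) = M.transpose.mulVec y := by
      rw [← hy]; ext c
      simp [Matrix.mulVec, dotProduct, hM, mul_comm]
    have hx : ∀ b, ev p ((N * N.transpose).adjugate.mulVec (N.mulVec s) b)
        = ((M * M.transpose).adjugate.mulVec (M.mulVec (fun c => ev p (s c)))) b := by
      intro b
      have e1 : ((N * N.transpose).adjugate).map (ev p) = (M * M.transpose).adjugate := by
        have := AlgHom.map_adjugate (ev p) (N * N.transpose)
        simp only [AlgHom.mapMatrix_apply] at this
        rw [this]; congr 1
        ext i j; simp [Matrix.mul_apply, hM]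
      rw [← e1]
      simp [Matrix.mulVec, dotProduct, hM]
    have hd : ev p (N * N.transpose).det = (M * M.transpose).det := by
      rw [AlgHom.map_det]; congr 1
      ext i j; simp [Matrix.mul_apply, hM]
    rw [map_sub, map_mul, map_sum, hd]
    simp only [map_mul, hx]
    have hz : (M * M.transpose).adjugate.mulVec (M.mulVec (fun c => ev p (s c)))
        = (M * M.transpose).det • y := by
      rw [hy', Matrix.mulVec_mulVec, Matrix.mulVec_mulVec, Matrix.mul_assoc, Matrix.adjugate_mul,
        Matrix.smul_mulVec, Matrix.one_mulVec]
    have hy2 := congrFun hy c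
    simp only [Finset.sum_apply, Pi.smul_apply, smul_eq_mul] at hy2
    rw [hz, ← hy2, sub_eq_zero, Finset.mul_sum]
    simp only [Pi.smul_apply, smul_eq_mul]
    exact Finset.sum_congr rfl fun b _ => by ring

lemma surj_of_indep {V ι : Type*} [AddCommGroup V] [Module ℝ V] [Fintype ι] [DecidableEq ι]
    (A : V →ₗ[ℝ] (ι → ℝ))
    (h : ∀ a : ι → ℝ, (∀ v, ∑ i, a i * A v i = 0) → a = 0) : Function.Surjective A := by
  rw [← LinearMap.range_eq_top]
  by_contra hne
  obtain ⟨f, hf0, hf⟩ := Submodule.exists_le_ker_of_lt_top _ (lt_top_iff_ne_top.2 hne)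
  apply hf0
  have ha := h (fun i => f (Pi.single i 1)) (fun v => by
    have : f (A v) = 0 := hf ⟨v, rfl⟩
    rw [← this, LinearMap.pi_apply_eq_sum_univ f (A v)]
    refine Finset.sum_congr rfl fun i _ => ?_
    rw [smul_eq_mul, mul_comm]
    congr 2
    ext j
    simp [Pi.single_apply, eq_comm])
  refine LinearMap.pi_ext' fun i => ?_
  ext
  simpa using congrFun ha i

lemma rows_indep {n d : ℕ} {B : Type*} (p : Cfg n d) (f : B → MvPolynomial (Fin n × Fin d) ℚ)
    (h : LinearIndependent ℝ (fun b => gradP (f b) p)) :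
    LinearIndependent ℝ (fun b (v : Fin n × Fin d) => ev p (pderiv v (f b))) := by
  let L : ((Fin n × Fin d) → ℝ) →ₗ[ℝ] (Cfg n d →L[ℝ] ℝ) :=
    { toFun := fun a => ∑ v : Fin n × Fin d, a v •
        ((ContinuousLinearMap.proj v.2 : (Fin d → ℝ) →L[ℝ] ℝ).comp
        (ContinuousLinearMap.proj v.1 : Cfg n d →L[ℝ] (Fin d → ℝ)))
      map_add' := fun a b => by simp [add_smul, Finset.sum_add_distrib]
      map_smul' := fun a b => by simp [mul_smul, Finset.smul_sum] }
  exact LinearIndependent.of_comp L h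

lemma grad_single {n d : ℕ} (p : Cfg n d) (f : MvPolynomial (Fin n × Fin d) ℚ)
    (v : Fin n × Fin d) :
    gradP f p (Pi.single v.1 (Pi.single v.2 1)) = ev p (pderiv v f) := by
  rw [gradP_apply, Finset.sum_eq_single v]
  · simp
  · intro w _ hw
    by_cases h1 : w.1 = v.1
    · have h2 : w.2 ≠ v.2 := fun h2 => hw (Prod.ext h1 h2)
      rw [h1]; simp [h2]
    · simp [h1]
  · simp

lemma rows_span {n d : ℕ} {B : Type*} [Fintype B] (p : Cfg n d)
    (f : B → MvPolynomial (Fin n × Fin d) ℚ) (s : MvPolynomial (Fin n × Fin d) ℚ)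
    (h : gradP s p ∈ Submodule.span ℝ (Set.range fun b => gradP (f b) p)) :
    (fun v => ev p (pderiv v s)) ∈
      Submodule.span ℝ (Set.range (fun b (v : Fin n × Fin d) => ev p (pderiv v (f b)))) := by
  obtain ⟨y, hy⟩ := (Submodule.mem_span_range_iff_exists_fun ℝ).1 h
  refine (Submodule.mem_span_range_iff_exists_fun ℝ).2 ⟨y, ?_⟩
  ext v
  rw [← grad_single p s v, ← hy]
  simp [grad_single]

lemma surj_grad {n d : ℕ} {B : Type*} [Fintype B] [DecidableEq B] (p : Cfg n d)
    (f : B → MvPolynomial (Fin n × Fin d) ℚ)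
    (h : LinearIndependent ℝ (fun b => gradP (f b) p)) :
    Function.Surjective (ContinuousLinearMap.pi fun b => gradP (f b) p : Cfg n d →L[ℝ] (B → ℝ)) := by
  refine surj_of_indep
    ((ContinuousLinearMap.pi fun b => gradP (f b) p : Cfg n d →L[ℝ] (B → ℝ)) : Cfg n d →ₗ[ℝ] (B → ℝ))
    fun a ha => ?_
  have := Fintype.linearIndependent_iff.1 h a (by
    ext v
    simpa using ha v)
  exact funext this

open Filter Topology in
lemma curve {n d : ℕ} {B : Type*} [Fintype B] [DecidableEq B] (p : Cfg n d)
    (f : B → MvPolynomial (Fin n × Fin d) ℚ)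
    (h : LinearIndependent ℝ (fun b => gradP (f b) p)) (v : Cfg n d)
    (hv : ∀ b, gradP (f b) p v = 0) :
    ∃ c : ℝ → Cfg n d, ContDiffAt ℝ 1 c 0 ∧ c 0 = p ∧ HasDerivAt c v 0 ∧
      ∀ᶠ t in 𝓝 (0 : ℝ), ∀ b, ev (c t) (f b) = ev p (f b) := by
  set A : Cfg n d →L[ℝ] (B → ℝ) := ContinuousLinearMap.pi fun b => gradP (f b) p with hA
  have hsurj : Function.Surjective A := surj_grad p f h
  obtain ⟨S0, hS0⟩ := (A : Cfg n d →ₗ[ℝ] (B → ℝ)).exists_rightInverse_of_surjective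
    (LinearMap.range_eq_top.2 hsurj)
  set S : (B → ℝ) →L[ℝ] Cfg n d := LinearMap.toContinuousLinearMap S0 with hS
  have hAS : ∀ x, A (S x) = x := fun x => LinearMap.congr_fun hS0 x
  have hAv : A v = 0 := by ext b; exact hv b
  let fB : Cfg n d → (B → ℝ) := fun q b => ev q (f b)
  have hfB : HasFDerivAt fB A p := hasFDerivAt_pi.2 fun b => hasFDerivAt_ev (f b) p
  have hcB : ContDiff ℝ 1 fB := contDiff_pi.2 fun b => contDiff_ev (f b)
  let Φ : Cfg n d → Cfg n d := fun q => q + S (fB q - A q)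
  have hΦ : HasFDerivAt Φ ((ContinuousLinearEquiv.refl ℝ (Cfg n d) : Cfg n d ≃L[ℝ] Cfg n d) :
      Cfg n d →L[ℝ] Cfg n d) p := by
    have := (hasFDerivAt_id p).add (S.hasFDerivAt.comp p (hfB.sub A.hasFDerivAt))
    convert! this using 1
    ext x : 1
    simp
  have hcΦ : ContDiffAt ℝ 1 Φ p := by
    have : ContDiff ℝ 1 Φ := contDiff_id.add (S.contDiff.comp (hcB.sub A.contDiff))
    exact this.contDiffAt
  have hst := hcΦ.hasStrictFDerivAt' hΦ one_ne_zero
  let Ψ := hst.localInverse Φ _ p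
  have hΨc : ContDiffAt ℝ 1 Ψ (Φ p) := hcΦ.to_localInverse hΦ one_ne_zero
  have hΨ0 : Ψ (Φ p) = p := hst.localInverse_apply_image
  have hΨd := hst.to_localInverse
  have hΨr : ∀ᶠ y in 𝓝 (Φ p), Φ (Ψ y) = y := hst.eventually_right_inverse
  let l : ℝ → Cfg n d := fun t => Φ p + t • v
  have hl0 : l 0 = Φ p := by simp [l]
  have hlc : ContDiff ℝ 1 l := by fun_prop
  have hld : HasDerivAt l v 0 := by
    have := ((hasDerivAt_id (0 : ℝ)).smul_const v).const_add (Φ p)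
    simp only [one_smul, id] at this
    exact this
  refine ⟨fun t => Ψ (l t), ?_, ?_, ?_, ?_⟩
  · exact ContDiffAt.comp (0 : ℝ) (by rw [hl0]; exact hΨc) hlc.contDiffAt
  · simp only [hl0, hΨ0]
  · have h2 : HasFDerivAt (𝕜 := ℝ) Ψ
        ((ContinuousLinearEquiv.refl ℝ (Cfg n d)).symm : Cfg n d →L[ℝ] Cfg n d) (l 0) := by rw [hl0]; exact hΨd.hasFDerivAt
    exact h2.comp_hasDerivAt (0 : ℝ) hld
  · have ht : Tendsto l (𝓝 0) (𝓝 (Φ p)) := by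
      rw [← hl0]; exact hlc.continuous.continuousAt
    filter_upwards [ht.eventually hΨr] with t ht b
    have hAΦ : ∀ q, A (Φ q) = fB q := fun q => by simp [Φ, hAS]
    have : fB (Ψ (l t)) = fB p := by
      rw [← hAΦ, ht, ← hAΦ]; simp [l, hAv]
    exact congrFun this b

open Filter Topology in
lemma curve_const {n d : ℕ} {B : Type*} [Fintype B] [DecidableEq B] (p : Cfg n d)
    (hp : IsGeneric d p)
    (f : B → MvPolynomial (Fin n × Fin d) ℚ)
    (h : LinearIndependent ℝ (fun b => gradP (f b) p))
    (c : ℝ → Cfg n d) (hc : ContDiffAt ℝ 1 c 0) (hc0 : c 0 = p)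
    (hcB : ∀ᶠ t in 𝓝 (0 : ℝ), ∀ b, ev (c t) (f b) = ev p (f b))
    (s : MvPolynomial (Fin n × Fin d) ℚ)
    (hs : gradP s p ∈ Submodule.span ℝ (Set.range fun b => gradP (f b) p)) :
    ∀ᶠ t in 𝓝 (0 : ℝ), ev (c t) s = ev p s := by
  obtain ⟨m, x, hm, hx⟩ := gram p hp (fun b v => pderiv v (f b)) (fun v => pderiv v s)
    (rows_indep p f h) (rows_span p f s hs)
  have h1 : ∀ᶠ t in 𝓝 (0 : ℝ), ev (c t) m ≠ 0 := by
    have : ContinuousAt (fun t => ev (c t) m) 0 :=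
      ((contDiff_ev m).continuous.continuousAt).comp hc.continuousAt
    apply this.eventually_ne
    rwa [hc0]
  have h2 : ∀ᶠ t in 𝓝 (0 : ℝ), DifferentiableAt ℝ c t := by
    filter_upwards [hc.eventually (by simp)] with t ht using ht.differentiableAt one_ne_zero
  have h3 : ∀ᶠ t in 𝓝 (0 : ℝ), HasDerivAt (fun t => ev (c t) s) 0 t := by
    filter_upwards [h1, h2, hcB.eventually_nhds] with t hm hd hB
    have hd' := hd.hasDerivAt
    have hder : ∀ g, HasDerivAt (fun t => ev (c t) g) (gradP g (c t) (deriv c t)) t :=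
      fun g => (hasFDerivAt_ev g (c t)).comp_hasDerivAt t hd'
    have hz : ∀ b, gradP (f b) (c t) (deriv c t) = 0 := by
      intro b
      refine (hder (f b)).unique ?_
      refine (hasDerivAt_const t (ev p (f b))).congr_of_eventuallyEq ?_
      filter_upwards [hB] with u hu using hu b
    have key : ev (c t) m * gradP s (c t) (deriv c t) = 0 := by
      have : ev (c t) m * gradP s (c t) (deriv c t)
          = ∑ b, ev (c t) (x b) * gradP (f b) (c t) (deriv c t) := by
        simp only [gradP_apply, Finset.mul_sum]
        rw [Finset.sum_comm]
        refine Finset.sum_congr rfl fun v _ => ?_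
        rw [← mul_assoc, ← map_mul, hx v, map_sum, Finset.sum_mul]
        simp [mul_assoc]
      rw [this]; simp [hz]
    have := (mul_eq_zero.1 key).resolve_left hm
    rw [← this]
    exact hder s
  obtain ⟨ε, hε, hball⟩ := Metric.eventually_nhds_iff_ball.1 h3
  filter_upwards [Metric.ball_mem_nhds (0 : ℝ) hε] with t ht
  have := (convex_ball (0 : ℝ) ε).is_const_of_fderivWithin_eq_zero (𝕜 := ℝ)
    (f := fun t => ev (c t) s)
    (fun u hu => (hball u hu).differentiableAt.differentiableWithinAt)
    (fun u hu => by
      rw [fderivWithin_of_isOpen Metric.isOpen_ball hu]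
      have := (hball u hu).hasFDerivAt.fderiv
      rw [this]; ext; simp) ht (Metric.mem_ball_self hε)
  simpa [hc0] using this

def Hc {n d : ℕ} (q : Cfg n d) (j : Fin n) : Fin (d + 1) → ℝ := Fin.cons 1 (q j)

lemma Dm_apply {n d : ℕ} (g : Fin (d + 1) → Fin n) (q : Cfg n d) (a k : Fin (d + 1)) :
    Dm g q a k = Hc q (g k) a := by
  refine Fin.cases ?_ (fun i => ?_) a <;> simp [Dm, Hc]

lemma Dm_update {n d : ℕ} (g : Fin (d + 1) → Fin n) (q : Cfg n d) (i : Fin (d + 1)) (j : Fin n) :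
    (Dm g q).updateCol i (Hc q j) = Dm (Function.update g i j) q := by
  ext a k
  rw [Dm_apply, Matrix.updateCol_apply, Dm_apply]
  by_cases h : k = i
  · subst h; simp
  · simp [h]

lemma Dm_noninj {n d : ℕ} (g : Fin (d + 1) → Fin n) (q : Cfg n d) {k l : Fin (d + 1)}
    (hkl : k ≠ l) (h : g k = g l) : (Dm g q).det = 0 :=
  Matrix.det_zero_of_column_eq hkl fun a => by rw [Dm_apply, Dm_apply, h]

lemma hasDerivAt_line {n d : ℕ} (f : MvPolynomial (Fin n × Fin d) ℚ) (p v : Cfg n d) :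
    HasDerivAt (fun t : ℝ => ev (p + t • v) f) (gradP f p v) 0 := by
  have hl : HasDerivAt (fun t : ℝ => p + t • v) v 0 := by
    have := ((hasDerivAt_id (0 : ℝ)).smul_const v).const_add p
    simp only [one_smul, id] at this
    exact this
  have h2 : HasFDerivAt (fun q : Cfg n d => ev q f) (gradP f p) (p + (0 : ℝ) • v) := by
    simpa using hasFDerivAt_ev f p
  exact h2.comp_hasDerivAt (0 : ℝ) hl

lemma dir0 {n d : ℕ} (g : Fin (d + 1) → Fin n) (p : Cfg n d) (j : Fin n) (w : Fin d → ℝ)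
    (h : ∀ k, g k ≠ j) : gradP (Pm g).det p (Pi.single j w) = 0 := by
  refine (hasDerivAt_line (Pm g).det p (Pi.single j w)).unique ?_
  convert! hasDerivAt_const (0 : ℝ) ((Dm g p).det) using 1
  ext t
  rw [ev_Pm]
  congr 1
  ext a k
  rw [Dm_apply, Dm_apply]
  unfold Hc
  simp [h k]

lemma dir1 {n d : ℕ} (g : Fin (d + 1) → Fin n) (p : Cfg n d) (j : Fin n) (w : Fin d → ℝ)
    (i : Fin (d + 1)) (hi : g i = j)
    (h : ∀ k, k ≠ i → g k ≠ j) :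
    gradP (Pm g).det p (Pi.single j w) = ((Dm g p).updateCol i (Fin.cons 0 w)).det := by
  refine (hasDerivAt_line (Pm g).det p (Pi.single j w)).unique ?_
  set K := ((Dm g p).updateCol i (Fin.cons 0 w)).det with hK
  have : (fun t : ℝ => ev (p + t • (Pi.single j w : Cfg n d)) (Pm g).det)
      = fun t => (Dm g p).det + t * K := by
    ext t
    have e : Dm g (p + t • (Pi.single j w : Cfg n d))
        = (Dm g p).updateCol i (Hc p j + t • (Fin.cons 0 w : Fin (d + 1) → ℝ)) := by
      ext a k
      rw [Dm_apply, Matrix.updateCol_apply, Dm_apply]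
      by_cases hk : k = i
      · subst hk
        rw [hi]
        refine Fin.cases ?_ (fun i => ?_) a <;> simp [Hc]
      · unfold Hc
        simp [hk, h k hk]
    rw [ev_Pm, e, Matrix.det_updateCol_add, Matrix.det_updateCol_smul, Dm_update, ← hi,
      Function.update_eq_self]
  rw [this]
  have := ((hasDerivAt_id (0 : ℝ)).mul_const K).const_add ((Dm g p).det)
  simp only [one_mul, id] at this
  exact this

lemma dir2 {n d : ℕ} (g : Fin (d + 1) → Fin n) (p : Cfg n d) (j j1 j2 : Fin n)
    (i : Fin (d + 1)) (hi : g i = j) (h : ∀ k, k ≠ i → g k ≠ j) :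
    gradP (Pm g).det p (Pi.single j (p j1 - p j2)) =
      (Dm (Function.update g i j1) p).det - (Dm (Function.update g i j2) p).det := by
  rw [dir1 g p j _ i hi h]
  have : (Fin.cons 0 (p j1 - p j2) : Fin (d + 1) → ℝ) = Hc p j1 + (-1 : ℝ) • Hc p j2 := by
    ext a
    refine Fin.cases ?_ (fun i => ?_) a <;> simp [Hc, sub_eq_add_neg]
  rw [this, Matrix.det_updateCol_add, Matrix.det_updateCol_smul, Dm_update, Dm_update]
  ring

lemma tb_lt {n d : ℕ} (j : Fin (n - (d + 1))) : d + 1 + j.val < n := by omega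

lemma bary_lt {n d : ℕ} {j : Fin n} (h : ¬ j.val < d + 1) : j.val - (d + 1) < n - (d + 1) := by
  omega

section frame
variable {n d : ℕ} (hn : d + 1 ≤ n)

def eb : Fin (d + 1) → Fin n := Fin.castLE hn

def tb (j : Fin (n - (d + 1))) : Fin n := ⟨d + 1 + j.val, tb_lt j⟩

abbrev TI (n d : ℕ) := Option (Fin d × Fin (n - (d + 1)))

def gT : TI n d → Fin (d + 1) → Fin n
  | none => eb hn
  | some (i, j) => Function.update (eb hn) i.succ (tb j)

lemma eb_inj : Function.Injective (eb hn) := Fin.castLE_injective hn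

lemma eb_ne_tb (k : Fin (d + 1)) (j : Fin (n - (d + 1))) : eb hn k ≠ tb j := by
  intro h
  have := congrArg Fin.val h
  simp [eb, tb] at this
  omega

lemma tb_inj : Function.Injective (tb : Fin (n - (d + 1)) → Fin n) := by
  intro a b h
  have := congrArg Fin.val h
  simp [tb] at this
  exact Fin.ext this

lemma gT_inj (ι : TI n d) : Function.Injective (gT hn ι) := by
  rcases ι with _ | ⟨i, j⟩
  · exact eb_inj hn
  · intro a b hab
    simp only [gT, Function.update_apply] at hab
    split_ifs at hab with h1 h2 h2
    · rw [h1, h2]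
    · exact absurd hab.symm (eb_ne_tb hn _ _)
    · exact absurd hab (eb_ne_tb hn _ _)
    · exact eb_inj hn hab

lemma D_eb_ne (p : Cfg n d) (hp : IsGeneric d p) : (Dm (eb hn) p).det ≠ 0 := by
  rw [← ev_Pm]
  apply hp
  intro h0
  let q : Cfg n d := fun j i => if j.val = i.val + 1 then 1 else 0
  have h1 : (Dm (eb hn) q).det = 0 := by rw [← ev_Pm, h0, map_zero]
  have h2 : (Dm (eb hn) q).det = 1 := by
    rw [Matrix.det_of_isUpperTriangular]
    · refine Finset.prod_eq_one fun a _ => ?_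
      rw [Dm_apply]
      refine Fin.cases ?_ (fun i => ?_) a <;> simp [Hc, q, eb]
    · intro a k hak
      rw [Dm_apply]
      revert hak
      refine Fin.cases ?_ (fun i => ?_) a
      · intro hak; exact absurd hak (Fin.not_lt_zero _)
      · intro hak
        have : k.val < i.val + 1 := hak
        simp [Hc, q, eb]
        omega
  rw [h1] at h2
  exact zero_ne_one h2

lemma T_indep (hd : 1 ≤ d) (p : Cfg n d) (hp : IsGeneric d p) :
    LinearIndependent ℝ (fun ι : TI n d => gradP (Pm (gT hn ι)).det p) := by
  have hE := D_eb_ne hn p hp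
  rw [Fintype.linearIndependent_iff]
  intro a ha
  have hav : ∀ v, ∑ ι, a ι * gradP (Pm (gT hn ι)).det p v = 0 := fun v => by
    have := congrArg (fun φ : Cfg n d →L[ℝ] ℝ => φ v) ha
    simpa using this
  have hsome : ∀ i j, a (some (i, j)) = 0 := by
    intro i j
    have h := hav (Pi.single (tb j) (p (eb hn i.succ) - p (eb hn 0)))
    rw [Finset.sum_eq_single (some (i, j))] at h
    · have h2 : gradP (Pm (gT hn (some (i, j)))).det p
          (Pi.single (tb j) (p (eb hn i.succ) - p (eb hn 0))) = (Dm (eb hn) p).det := by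
        rw [dir2 _ p (tb j) _ _ i.succ (by simp [gT])
          (fun k hk => by simp [gT, hk, eb_ne_tb])]
        simp only [gT, Function.update_idem, Function.update_eq_self]
        rw [Dm_noninj (Function.update (eb hn) i.succ (eb hn 0)) p (Fin.succ_ne_zero i)
          (by simp [Function.update_of_ne (Fin.succ_ne_zero i).symm]), sub_zero]
      rw [h2] at h
      exact (mul_eq_zero.1 h).resolve_right hE
    · rintro (_ | ⟨i', j'⟩) - hne
      · rw [dir0 (gT hn none) _ _ _ (fun k => eb_ne_tb hn k j), mul_zero]
      · by_cases hj : j' = j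
        · subst hj
          have hi : i ≠ i' := fun h => hne (by rw [h])
          rw [dir2 _ p (tb j') _ _ i'.succ (by simp [gT])
            (fun k hk => by simp [gT, hk, eb_ne_tb])]
          simp only [gT, Function.update_idem]
          have hi' : i.succ ≠ i'.succ := fun h => hi (Fin.succ_injective _ h)
          rw [Dm_noninj (Function.update (eb hn) i'.succ (eb hn 0)) p (Fin.succ_ne_zero i')
            (by simp [Function.update_of_ne (Fin.succ_ne_zero i').symm]),
            Dm_noninj (Function.update (eb hn) i'.succ (eb hn i.succ)) p hi'.symm
            (by simp [Function.update_of_ne hi'])]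
          simp
        · rw [dir0, mul_zero]
          intro k
          simp only [gT, Function.update_apply]
          split_ifs
          · exact fun h => hj (tb_inj h)
          · exact eb_ne_tb hn _ _
    · simp
  intro ι
  rcases ι with _ | ⟨i, j⟩
  · let i0 : Fin d := ⟨0, hd⟩
    have h := hav (Pi.single (eb hn i0.succ) (p (eb hn i0.succ) - p (eb hn 0)))
    rw [Fintype.sum_option] at h
    simp only [hsome, zero_mul, Finset.sum_const_zero, add_zero] at h
    rw [dir2 (gT hn none) p (eb hn i0.succ) _ _ i0.succ rfl
      (fun k hk => fun h => hk (eb_inj hn h))] at h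
    have hgn : gT hn none = eb hn := rfl
    simp only [hgn, Function.update_eq_self] at h
    rw [Dm_noninj (Function.update (eb hn) i0.succ (eb hn 0)) p (Fin.succ_ne_zero i0)
          (by simp [Function.update_of_ne (Fin.succ_ne_zero i0).symm]), sub_zero] at h
    exact (mul_eq_zero.1 h).resolve_right hE
  · exact hsome i j

noncomputable def fT (q : Cfg n d) : TI n d → ℝ := fun ι => ev q (Pm (gT hn ι)).det

noncomputable def bary (y : TI n d → ℝ) (j : Fin n) (a : Fin (d + 1)) : ℝ :=
  if h : j.val < d + 1 then (if a = ⟨j.val, h⟩ then 1 else 0)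
  else (Fin.cons (1 - ∑ i : Fin d, y (some (i, ⟨j.val - (d + 1), bary_lt h⟩)) / y none)
    (fun i : Fin d => y (some (i, ⟨j.val - (d + 1), bary_lt h⟩)) / y none) : Fin (d + 1) → ℝ) a

noncomputable def GT (g : Fin (d + 1) → Fin n) (y : TI n d → ℝ) : ℝ :=
  y none * (Matrix.of fun a k => bary y (g k) a).det

lemma bary_spec (q : Cfg n d) (hq : (Dm (eb hn) q).det ≠ 0) (j : Fin n) :
    (Dm (eb hn) q).mulVec (bary (fT hn q) j) = Hc q j := by
  by_cases h : j.val < d + 1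
  · ext a
    have : eb hn ⟨j.val, h⟩ = j := rfl
    simp only [Matrix.mulVec, dotProduct, bary, h, dite_true, Dm_apply]
    simp [this]
  · obtain ⟨j', rfl⟩ : ∃ j' : Fin (n - (d + 1)), j = tb j' := ⟨⟨j.val - (d + 1), by omega⟩, by
      apply Fin.ext; simp [tb]; omega⟩
    set x : Fin (d + 1) → ℝ :=
      (Dm (eb hn) q).det⁻¹ • Matrix.cramer (Dm (eb hn) q) (Hc q (tb j')) with hx
    have hMx : (Dm (eb hn) q).mulVec x = Hc q (tb j') := by
      rw [hx, Matrix.mulVec_smul, Matrix.mulVec_cramer, smul_smul, inv_mul_cancel₀ hq, one_smul]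
    have hsum : ∑ a, x a = 1 := by
      have := congrFun hMx 0
      simpa [Matrix.mulVec, dotProduct, Dm_apply, Hc] using this
    have hxs : ∀ i : Fin d, x i.succ = fT hn q (some (i, j')) / fT hn q none := by
      intro i
      simp only [hx, Pi.smul_apply, Matrix.cramer_apply, Dm_update, smul_eq_mul, fT, ev_Pm, gT]
      rw [div_eq_inv_mul]
    have : bary (fT hn q) (tb j') = x := by
      ext a
      have hj' : (⟨(tb j' : Fin n).val - (d + 1), bary_lt h⟩ : Fin (n - (d + 1))) = j' := by
        apply Fin.ext; simp [tb]
      simp only [bary, h, dite_false, hj']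
      refine Fin.cases ?_ (fun i => ?_) a
      · rw [Fin.sum_univ_succ] at hsum
        simp only [Fin.cons_zero, ← hxs]
        linarith
      · simp [hxs]
    rw [this, hMx]

lemma GT_spec (q : Cfg n d) (hq : (Dm (eb hn) q).det ≠ 0) (g : Fin (d + 1) → Fin n) :
    (Dm g q).det = GT g (fT hn q) := by
  have : Dm g q = Dm (eb hn) q * (Matrix.of fun a k => bary (fT hn q) (g k) a) := by
    ext a k
    rw [Dm_apply, ← bary_spec hn q hq]
    rfl
  rw [this, Matrix.det_mul, GT]
  congr 1
  simp [fT, ev_Pm, gT]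

lemma GT_smooth (g : Fin (d + 1) → Fin n) (y : TI n d → ℝ) (hy : y none ≠ 0) :
    ContDiffAt ℝ 1 (GT g) y := by
  have hc : ∀ ι, ContDiffAt ℝ 1 (fun y : TI n d → ℝ => y ι) y := fun ι => by fun_prop
  have hb : ∀ j a, ContDiffAt ℝ 1 (fun y : TI n d → ℝ => bary y j a) y := by
    intro j a
    unfold bary
    split_ifs
    · exact contDiffAt_const
    · exact contDiffAt_const
    · refine Fin.cases ?_ (fun i => ?_) a
      · simp only [Fin.cons_zero]
        exact contDiffAt_const.sub (ContDiffAt.sum fun i _ => (hc _).div (hc _) hy)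
      · simp only [Fin.cons_succ]
        exact (hc _).div (hc _) hy
  unfold GT
  refine (hc none).mul ?_
  simp only [Matrix.det_apply', Matrix.of_apply]
  exact ContDiffAt.sum fun σ _ => contDiffAt_const.mul (contDiffAt_prod fun i _ => hb _ _)

lemma card_TI (hd : 1 ≤ d) (hn : d + 1 ≤ n) :
    Fintype.card (TI n d) = d * n - (d ^ 2 + d - 1) := by
  obtain ⟨m, rfl⟩ := Nat.exists_eq_add_of_le hn
  simp only [Fintype.card_option, Fintype.card_prod, Fintype.card_fin, Nat.add_sub_cancel_left]
  have : d * (d + 1 + m) = d * m + d ^ 2 + d := by ring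
  omega

end frame

lemma fderiv_vol {n d : ℕ} (σ : Finset (Fin n)) (p : Cfg n d) :
    fderiv ℝ (vol d σ) p = gradP (volP d σ) p := by
  rw [vol_eq]; exact (hasFDerivAt_ev _ _).fderiv

open Filter Topology in
lemma forward {n d : ℕ} (hd : 1 ≤ d) (hn : d + 1 ≤ n)
    (F : Finset (Finset (Fin n))) (p : Cfg n d) (hp : IsGeneric d p)
    (hR : LocallyRigid d F p) :
    ∃ B ⊆ F, B.card = d * n - (d ^ 2 + d - 1) ∧
        LinearIndependent ℝ fun σ : B => gradP (volP d σ.1) p := by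
  classical
  obtain ⟨U, hU, hpU, hR⟩ := hR
  obtain ⟨b, hbF, -, hspan, hli⟩ := exists_linearIndepOn_extension (K := ℝ)
    (v := fun σ : Finset (Fin n) => gradP (volP d σ) p) (s := ∅) (t := (F : Set (Finset (Fin n))))
    (linearIndepOn_empty _ _) (Set.empty_subset _)
  obtain ⟨B, rfl⟩ := (F.finite_toSet.subset hbF).exists_finset_coe
  have hBF : B ⊆ F := by exact_mod_cast hbF
  have hB : LinearIndependent ℝ fun σ : B => gradP (volP d σ.1) p := hli
  have hker : ∀ v, (∀ σ : B, gradP (volP d σ.1) p v = 0) →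
      ∀ ι : TI n d, gradP (Pm (gT hn ι)).det p v = 0 := by
    intro v hv ι
    obtain ⟨c, hc, hc0, hcd, hcB⟩ := curve p (fun σ : B => volP d σ.1) hB v hv
    have hF : ∀ᶠ t in 𝓝 (0 : ℝ), ∀ σ ∈ F, vol d σ (c t) = vol d σ p := by
      rw [Finset.eventually_all]
      intro σ hσ
      simp only [vol_eq]
      refine curve_const p hp (fun σ : B => volP d σ.1) hB c hc hc0 hcB _ ?_
      have := hspan ⟨σ, hσ, rfl⟩
      rw [Set.image_eq_range] at this
      exact this
    obtain ⟨σ, ε, hσ, hD⟩ := D_eq_vol (d := d) (gT hn ι) (gT_inj hn ι)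
    have hUc : ∀ᶠ t in 𝓝 (0 : ℝ), c t ∈ U := by
      apply hc.continuousAt.eventually_mem
      rw [hc0]; exact hU.mem_nhds hpU
    have hconst : ∀ᶠ t in 𝓝 (0 : ℝ), ev (c t) (Pm (gT hn ι)).det = ev p (Pm (gT hn ι)).det := by
      filter_upwards [hF, hUc] with t h1 h2
      rw [ev_Pm, ev_Pm, hD, hD, hR _ h2 h1 σ hσ]
    have h1 : HasDerivAt (fun t => ev (c t) (Pm (gT hn ι)).det)
        (gradP (Pm (gT hn ι)).det (c 0) v) 0 :=
      (hasFDerivAt_ev (Pm (gT hn ι)).det (c 0)).comp_hasDerivAt (0 : ℝ) hcd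
    rw [hc0] at h1
    exact h1.unique ((hasDerivAt_const (0 : ℝ) _).congr_of_eventuallyEq hconst)
  have hsB := surj_grad p _ hB
  have hsT := surj_grad p _ (T_indep hn hd p hp)
  set A : Cfg n d →L[ℝ] (B → ℝ) := ContinuousLinearMap.pi fun σ : B => gradP (volP d σ.1) p with hA
  set AT : Cfg n d →L[ℝ] (TI n d → ℝ) :=
    ContinuousLinearMap.pi fun ι => gradP (Pm (gT hn ι)).det p with hAT
  obtain ⟨S, hS⟩ := (A : Cfg n d →ₗ[ℝ] (B → ℝ)).exists_rightInverse_of_surjective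
    (LinearMap.range_eq_top.2 hsB)
  have hAS : ∀ x, A (S x) = x := fun x => LinearMap.congr_fun hS x
  have hsurj : Function.Surjective ((AT : Cfg n d →ₗ[ℝ] (TI n d → ℝ)) ∘ₗ S) := by
    intro z
    obtain ⟨x, rfl⟩ := hsT z
    refine ⟨A x, ?_⟩
    have h0 : A (x - S (A x)) = 0 := by rw [map_sub, hAS, sub_self]
    have h1 : AT (x - S (A x)) = 0 := by
      ext ι
      exact hker _ (fun σ => congrFun h0 σ) ι
    rw [map_sub, sub_eq_zero] at h1
    exact h1.symm
  have hcard := LinearMap.finrank_le_finrank_of_surjective hsurj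
  rw [Module.finrank_fintype_fun_eq_card, Module.finrank_fintype_fun_eq_card, card_TI hd hn,
    Fintype.card_coe] at hcard
  obtain ⟨B', hB', hc'⟩ := Finset.exists_subset_card_eq hcard
  refine ⟨B', hB'.trans hBF, hc', ?_⟩
  exact hB.comp (fun σ : B' => (⟨σ.1, hB' σ.2⟩ : B)) (fun a b h => by
    apply Subtype.ext; exact congrArg (fun x : B => x.1) h)

open Filter Topology in
lemma backward {n d : ℕ} (hd : 1 ≤ d) (hn : d + 1 ≤ n)
    (F : Finset (Finset (Fin n))) (hF : ∀ σ ∈ F, σ.card = d + 1)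
    (p : Cfg n d) (hp : IsGeneric d p)
    (B : Finset (Finset (Fin n))) (hBF : B ⊆ F) (hcard : B.card = d * n - (d ^ 2 + d - 1))
    (hB : LinearIndependent ℝ fun σ : B => gradP (volP d σ.1) p) :
    LocallyRigid d F p := by
  classical
  have hE := D_eb_ne hn p hp
  have hBc : ∀ σ : B, σ.1.card = d + 1 := fun σ => hF _ (hBF σ.2)
  let G : (TI n d → ℝ) → (B → ℝ) := fun y σ => GT (σ.1.orderEmbOfFin (hBc σ)) y
  have hy0 : fT hn p none ≠ 0 := by simpa [fT, ev_Pm, gT] using hE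
  have hG : ContDiffAt ℝ 1 G (fT hn p) := contDiffAt_pi.2 fun σ => GT_smooth _ _ hy0
  have hGs := hG.hasStrictFDerivAt one_ne_zero
  set G' := fderiv ℝ G (fT hn p) with hG'
  have hEv : ∀ᶠ q in 𝓝 p, (Dm (eb hn) q).det ≠ 0 := by
    have : Continuous fun q : Cfg n d => (Dm (eb hn) q).det := by
      simp only [← ev_Pm]
      exact (contDiff_ev _).continuous
    exact this.continuousAt.eventually_ne hE
  have hTd : HasFDerivAt (fT hn) (ContinuousLinearMap.pi fun ι => gradP (Pm (gT hn ι)).det p) p :=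
    hasFDerivAt_pi.2 fun ι => hasFDerivAt_ev _ p
  set AT : Cfg n d →L[ℝ] (TI n d → ℝ) :=
    ContinuousLinearMap.pi fun ι => gradP (Pm (gT hn ι)).det p with hAT
  let fB : Cfg n d → (B → ℝ) := fun q σ => vol d σ.1 q
  have hfG : ∀ q, (Dm (eb hn) q).det ≠ 0 → fB q = G (fT hn q) := by
    intro q hq
    ext σ
    simp only [fB, G]
    rw [vol_eq_D _ (hBc σ), GT_spec hn q hq]
  have hfB : HasFDerivAt fB (ContinuousLinearMap.pi fun σ : B => gradP (volP d σ.1) p) p :=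
    hasFDerivAt_pi.2 fun σ => by
      simp only [vol_eq]
      exact hasFDerivAt_ev _ p
  have hcomp : HasFDerivAt fB (G'.comp AT) p := by
    refine (hGs.hasFDerivAt.comp p hTd).congr_of_eventuallyEq ?_
    filter_upwards [hEv] with q hq using hfG q hq
  have hAeq := hfB.unique hcomp
  have hsB := surj_grad p _ hB
  have hG's : Function.Surjective (G' : (TI n d → ℝ) →ₗ[ℝ] (B → ℝ)) := by
    intro z
    obtain ⟨x, hx⟩ := hsB z
    refine ⟨AT x, ?_⟩
    rw [hAeq] at hx
    exact hx
  have hfr : Module.finrank ℝ (TI n d → ℝ) = Module.finrank ℝ (B → ℝ) := by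
    rw [Module.finrank_fintype_fun_eq_card, Module.finrank_fintype_fun_eq_card, card_TI hd hn,
      Fintype.card_coe, hcard]
  have hG'i : Function.Injective (G' : (TI n d → ℝ) →ₗ[ℝ] (B → ℝ)) :=
    (LinearMap.injective_iff_surjective_of_finrank_eq_finrank hfr).2 hG's
  let E : (TI n d → ℝ) ≃L[ℝ] (B → ℝ) :=
    (LinearEquiv.ofBijective (G' : (TI n d → ℝ) →ₗ[ℝ] (B → ℝ)) ⟨hG'i, hG's⟩).toContinuousLinearEquiv
  have hEG : (E : (TI n d → ℝ) →L[ℝ] (B → ℝ)) = G' := by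
    ext x : 1; rfl
  rw [← hEG] at hGs
  have hleft := hGs.eventually_left_inverse
  have hleft' := hTd.continuousAt.eventually hleft
  have hall := hEv.and hleft'
  obtain ⟨U, hUs, hU, hpU⟩ := eventually_nhds_iff.1 hall
  refine ⟨U, hU, hpU, fun q hq hvol τ hτ => ?_⟩
  obtain ⟨hq1, hq2⟩ := hUs q hq
  obtain ⟨hp1, hp2⟩ := hUs p hpU
  have hfe : fB q = fB p := by ext σ; exact hvol _ (hBF σ.2)
  rw [hfG q hq1, hfG p hp1] at hfe
  have : fT hn q = fT hn p := by rw [← hq2, hfe, hp2]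
  rw [vol_eq_D _ hτ, vol_eq_D _ hτ, GT_spec hn q hq1, GT_spec hn p hp1, this]

end VR

/-- A framework `(F, p)` at a generic configuration `p` is locally `d`-volume rigid iff `F`
contains a basis of the `d`-volume rigidity matroid: a subset `B` of cardinality
`d·n - (d² + d - 1)` whose volume gradients at `p` are linearly independent. -/
theorem locally_rigid_iff_contains_basis (d n : ℕ) (hd : 1 ≤ d) (hn : d + 1 ≤ n)
    (F : Finset (Finset (Fin n))) (hF : ∀ σ ∈ F, σ.card = d + 1)
    (p : Fin n → Fin d → ℝ) (hp : IsGeneric d p) :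
    LocallyRigid d F p ↔
      ∃ B ⊆ F, B.card = d * n - (d ^ 2 + d - 1) ∧
        LinearIndependent ℝ fun σ : B => fderiv ℝ (vol d σ.1) p := by
  simp only [VR.fderiv_vol]
  exact ⟨fun h => VR.forward hd hn F p hp h, fun ⟨B, hBF, hc, hB⟩ =>
    VR.backward hd hn F hF p hp B hBF hc hB⟩
end
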